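/- arXiv:2509.00409 — 2 statements merged into one kernel-verified Lean document; each statement's English description precedes it below -/
import Mathlib

section
/- Let γ be the standard Gaussian probability measure on ℝ and μ := ⊗_{n∈ℕ} γ on ℝ^ℕ. Let (a_n) and (b_n) be sequences with a_n ≤ 0 and b_n ≤ 0 for all n, such that both ∏_{n=1}^N γ([a_n,∞)) and ∏_{n=1}^N γ([b_n,∞)) converge to strictly positive limits; set A := {y ∈ ℝ^ℕ : y_n ≥ a_n for all n} and B := {y ∈ ℝ^ℕ : y_n ≥ b_n for all n}. Let (V^A_x)_{x∈ℝ₊^∞} and (V^B_x)_{x∈ℝ₊^∞} be the families of isometries on L²(A) and L²(B) respectively determined by: for x ∈ ℝ₊^∞ with x_n = 0 for n > k, (V^A_x f)(y) = (∏_{n=1}^k e^{(2 x_n y_n − x_n²)/2})^{1/2} f(y−x) if y−x ∈ A and 0 otherwise (μ-a.e. y ∈ A), and analogously for V^B on B. Then for every n ∈ ℕ there exists a unitary W : L²(A) → L²(B) such that W V^A_x = V^B_x W for every x ∈ ℝ₊^∞ with x_i = 0 for all i > n. (In particular, this holds even when Σ_n (a_n − b_n)² = ∞, so that V^A and V^B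 are locally unitarily equivalent on every finite block of coordinates without being unitarily equivalent.) -/
open ContinuousLinearMap Filter Topology MeasureTheory

/-- `μ` is the infinite product `⊗_{n∈ℕ} γ` of the standard Gaussian measure `γ` on `ℝ`:
it is a probability measure whose values on cylinder sets are the corresponding finite
products of Gaussian measures. -/
def IsGaussianProduct (μ : Measure (ℕ → ℝ)) : Prop :=
  IsProbabilityMeasure μ ∧
  ∀ (k : ℕ) (s : ℕ → Set ℝ), (∀ n, MeasurableSet (s n)) → (∀ n, k ≤ n → s n = Set.univ) →
    μ {y : ℕ → ℝ | ∀ n, y n ∈ s n}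
      = ∏ n ∈ Finset.range k, ProbabilityTheory.gaussianReal 0 1 (s n)

/-- `V` is the family of isometries `V^A` on `L²(A) = Lp ℂ 2 (μ.restrict A)` determined by
`(V_x f)(y) = (∏_{n<k} e^{(2 x_n y_n - x_n²)/2})^{1/2} f(y - x)` if `y - x ∈ A`, `0`
otherwise, for `x ∈ ℝ₊^∞` supported in the first `k` coordinates. -/
def IsGaussianShiftRep (μ : Measure (ℕ → ℝ)) (A : Set (ℕ → ℝ))
    (V : (ℕ → NNReal) → (Lp ℂ 2 (μ.restrict A) →L[ℂ] Lp ℂ 2 (μ.restrict A))) : Prop :=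
  (∀ x : ℕ → NNReal, (∃ k, ∀ n, k ≤ n → x n = 0) →
    ∀ f : Lp ℂ 2 (μ.restrict A), ‖V x f‖ = ‖f‖) ∧
  ∀ (x : ℕ → NNReal) (k : ℕ), (∀ n, k ≤ n → x n = 0) →
    ∀ f : Lp ℂ 2 (μ.restrict A),
      (V x f : (ℕ → ℝ) → ℂ) =ᵐ[μ.restrict A]
        Set.indicator {y : ℕ → ℝ | (fun n => y n - (x n : ℝ)) ∈ A}
          (fun y => (Real.sqrt (∏ n ∈ Finset.range k,
              Real.exp ((2 * (x n : ℝ) * y n - (x n : ℝ) ^ 2) / 2)) : ℂ)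
            * f (fun n => y n - (x n : ℝ)))

/-- The distribution function of a measure concentrated on `[a, ∞)`, continued with slope one to
the left of `a`. -/
noncomputable def extendedCdf (ν : Measure ℝ) (a y : ℝ) : ℝ :=
  ProbabilityTheory.cdf ν y - max (a - y) 0

/-- The standard Gaussian measure conditioned on `[a, ∞)`. -/
noncomputable def halfLineGaussian (a : ℝ) : Measure ℝ :=
  ProbabilityTheory.cond (ProbabilityTheory.gaussianReal 0 1) (Set.Ici a)

theorem gaussianReal_Ici_ne_zero (a : ℝ) :
    ProbabilityTheory.gaussianReal 0 1 (Set.Ici a) ≠ 0 := fun h => by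
  simpa using ProbabilityTheory.gaussianReal_absolutelyContinuous' 0 one_ne_zero h

instance isProbabilityMeasure_halfLineGaussian (a : ℝ) :
    IsProbabilityMeasure (halfLineGaussian a) :=
  ProbabilityTheory.cond_isProbabilityMeasure (gaussianReal_Ici_ne_zero a)

theorem halfLineGaussian_apply (a : ℝ) (s : Set ℝ) :
    halfLineGaussian a s = (ProbabilityTheory.gaussianReal 0 1 (Set.Ici a))⁻¹ *
      ProbabilityTheory.gaussianReal 0 1 (Set.Ici a ∩ s) :=
  ProbabilityTheory.cond_apply measurableSet_Ici _ _

theorem cdf_halfLineGaussian_of_lt {a y : ℝ} (h : y < a) :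
    ProbabilityTheory.cdf (halfLineGaussian a) y = 0 := by
  have : Set.Ici a ∩ Set.Iic y = ∅ := by
    ext z; simp; intro hz; linarith
  rw [ProbabilityTheory.cdf_eq_real, measureReal_def, halfLineGaussian_apply, this]
  simp

theorem cdf_halfLineGaussian_lt {a y z : ℝ} (hy : a ≤ y) (h : y < z) :
    ProbabilityTheory.cdf (halfLineGaussian a) y < ProbabilityTheory.cdf (halfLineGaussian a) z := by
  have hpos : halfLineGaussian a (Set.Ioc y z) ≠ 0 := by
    rw [halfLineGaussian_apply, Set.inter_eq_self_of_subset_right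
      (show Set.Ioc y z ⊆ Set.Ici a from fun w hw => hy.trans hw.1.le)]
    refine mul_ne_zero (by simp) fun h0 => ?_
    have := ProbabilityTheory.gaussianReal_absolutelyContinuous' 0 one_ne_zero h0
    simp at this
    linarith
  rw [← ProbabilityTheory.measure_cdf (halfLineGaussian a), StieltjesFunction.measure_Ioc] at hpos
  by_contra hle
  exact hpos (ENNReal.ofReal_of_nonpos (by linarith))

theorem continuous_cdf_halfLineGaussian (a : ℝ) :
    Continuous (ProbabilityTheory.cdf (halfLineGaussian a)) := by
  refine continuous_iff_continuousAt.2 fun x => ?_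
  rw [(ProbabilityTheory.monotone_cdf _).continuousAt_iff_leftLim_eq_rightLim,
    StieltjesFunction.rightLim_eq]
  have h0 : halfLineGaussian a {x} = 0 := by
    have := ProbabilityTheory.nullSingletonClass_gaussianReal (μ := 0) (v := 1) one_ne_zero
    rw [halfLineGaussian_apply, measure_mono_null Set.inter_subset_right (measure_singleton x),
      mul_zero]
  rw [← ProbabilityTheory.measure_cdf (halfLineGaussian a), StieltjesFunction.measure_singleton,
    ENNReal.ofReal_eq_zero] at h0
  exact le_antisymm ((ProbabilityTheory.monotone_cdf _).leftLim_le le_rfl) (by linarith)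

theorem strictMono_extendedCdf (a : ℝ) : StrictMono (extendedCdf (halfLineGaussian a) a) := by
  intro y z h
  unfold extendedCdf
  have hmono := ProbabilityTheory.monotone_cdf (halfLineGaussian a) h.le
  rcases le_or_gt a y with hy | hy
  · have := cdf_halfLineGaussian_lt hy h
    rw [max_eq_right (by linarith), max_eq_right (by linarith)]
    linarith
  · have : max (a - z) 0 < max (a - y) 0 := by
      rw [max_eq_left (by linarith : 0 ≤ a - y)]
      exact max_lt (by linarith) (by linarith)
    linarith

theorem extendedCdf_self (a : ℝ) : extendedCdf (halfLineGaussian a) a a = 0 := by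
  have h0 : halfLineGaussian a (Set.Iic a) = 0 := by
    have := ProbabilityTheory.nullSingletonClass_gaussianReal (μ := 0) (v := 1) one_ne_zero
    rw [halfLineGaussian_apply, Set.Ici_inter_Iic, Set.Icc_self, measure_singleton, mul_zero]
  simp [extendedCdf, ProbabilityTheory.cdf_eq_real, measureReal_def, h0]

theorem range_extendedCdf (a : ℝ) :
    Set.range (extendedCdf (halfLineGaussian a) a) = Set.Iio 1 := by
  have hle : ∀ y, extendedCdf (halfLineGaussian a) a y ≤ 1 := fun y => by
    have := ProbabilityTheory.cdf_le_one (halfLineGaussian a) y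
    have := le_max_right (a - y) 0
    unfold extendedCdf
    linarith
  ext v
  constructor
  · rintro ⟨y, rfl⟩
    exact (strictMono_extendedCdf a (lt_add_one y)).trans_le (hle _)
  · intro hv
    have hcont : Continuous (extendedCdf (halfLineGaussian a) a) :=
      (continuous_cdf_halfLineGaussian a).sub (by fun_prop)
    refine mem_range_of_exists_le_of_exists_ge hcont ⟨min (a + v - 1) a, ?_⟩ ?_
    · have := ProbabilityTheory.cdf_le_one (halfLineGaussian a) (min (a + v - 1) a)
      have := le_max_left (a - min (a + v - 1) a) 0
      have := min_le_left (a + v - 1) a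
      unfold extendedCdf
      linarith
    · obtain ⟨y, hy, hay⟩ := (((ProbabilityTheory.tendsto_cdf_atTop (halfLineGaussian a)).eventually
        (lt_mem_nhds hv)).and (eventually_ge_atTop a)).exists
      refine ⟨y, ?_⟩
      rw [extendedCdf, max_eq_right (by linarith)]
      linarith

/-- The monotone transport between two half-line conditionings of the Gaussian measure. -/
theorem exists_measurableEquiv_map_halfLineGaussian (a b : ℝ) :
    ∃ e : ℝ ≃ᵐ ℝ, (∀ y, b ≤ e y ↔ a ≤ y) ∧ (halfLineGaussian a).map e = halfLineGaussian b := by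
  let e : ℝ ≃o ℝ := ((strictMono_extendedCdf a).orderIso _).trans
    ((OrderIso.setCongr _ _ ((range_extendedCdf a).trans (range_extendedCdf b).symm)).trans
      ((strictMono_extendedCdf b).orderIso _).symm)
  have he : ∀ y, extendedCdf (halfLineGaussian b) b (e y) =
      extendedCdf (halfLineGaussian a) a y := fun y => by
    have : (strictMono_extendedCdf b).orderIso _ (e y) =
        OrderIso.setCongr _ _ ((range_extendedCdf a).trans (range_extendedCdf b).symm)
          ((strictMono_extendedCdf a).orderIso _ y) := by simp [e]
    exact congrArg Subtype.val this
  have hord : ∀ y, b ≤ e y ↔ a ≤ y := fun y => by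
    rw [← (strictMono_extendedCdf b).le_iff_le, he, extendedCdf_self, ← extendedCdf_self a,
      (strictMono_extendedCdf a).le_iff_le]
  refine ⟨e.toHomeomorph.toMeasurableEquiv, hord, ?_⟩
  have hmeas : Measurable e := e.monotone.measurable
  have : IsProbabilityMeasure ((halfLineGaussian a).map e) :=
    Measure.isProbabilityMeasure_map hmeas.aemeasurable
  refine Measure.eq_of_cdf ((halfLineGaussian a).map e) _ ?_
  ext z
  obtain ⟨y, rfl⟩ := e.surjective z
  have hpre : e ⁻¹' Set.Iic (e y) = Set.Iic y := by ext; simp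
  rw [ProbabilityTheory.cdf_eq_real, map_measureReal_apply hmeas measurableSet_Iic, hpre,
    ← ProbabilityTheory.cdf_eq_real]
  rcases le_or_gt a y with hy | hy
  · have := he y
    rw [extendedCdf, extendedCdf, max_eq_right (by linarith [(hord y).2 hy]),
      max_eq_right (by linarith)] at this
    linarith
  · rw [cdf_halfLineGaussian_of_lt hy,
      cdf_halfLineGaussian_of_lt (not_le.1 fun h => hy.not_ge ((hord y).1 h))]

theorem gaussianReal_eq_withDensity (t : ℝ) :
    ProbabilityTheory.gaussianReal t 1 = (ProbabilityTheory.gaussianReal 0 1).withDensity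
      fun y => ENNReal.ofReal (Real.exp (t * y - t ^ 2 / 2)) := by
  rw [ProbabilityTheory.gaussianReal_of_var_ne_zero _ one_ne_zero,
    ProbabilityTheory.gaussianReal_of_var_ne_zero _ one_ne_zero,
    ← withDensity_mul _ (ProbabilityTheory.measurable_gaussianPDF _ _) (by fun_prop)]
  congr 1
  ext y
  rw [Pi.mul_apply, ProbabilityTheory.gaussianPDF_def, ProbabilityTheory.gaussianPDF_def,
    ← ENNReal.ofReal_mul (ProbabilityTheory.gaussianPDFReal_nonneg _ _ _)]
  simp only [ProbabilityTheory.gaussianPDFReal, mul_assoc, ← Real.exp_add]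
  congr 3
  push_cast
  ring_nf

theorem map_add_halfLineGaussian (a b : ℝ) :
    ∃ c : ℝ, 0 < c ∧ (halfLineGaussian a).map (MeasurableEquiv.addRight (b - a)) =
      (halfLineGaussian b).withDensity
        fun y => ENNReal.ofReal (c * Real.exp ((b - a) * y - (b - a) ^ 2 / 2)) := by
  set γ := ProbabilityTheory.gaussianReal 0 1 with hγ
  have hpos : ∀ a, 0 < γ.real (Set.Ici a) := fun a =>
    ENNReal.toReal_pos (gaussianReal_Ici_ne_zero a) (measure_ne_top _ _)
  have hof : ∀ a, γ (Set.Ici a) = ENNReal.ofReal (γ.real (Set.Ici a)) := fun a => by simp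
  refine ⟨(γ.real (Set.Ici a))⁻¹ * γ.real (Set.Ici b), mul_pos (inv_pos.2 (hpos a)) (hpos b), ?_⟩
  have hpre : MeasurableEquiv.addRight (b - a) ⁻¹' Set.Ici b = Set.Ici a := by
    ext; simp
  have hmap : γ.map (MeasurableEquiv.addRight (b - a)) = γ.withDensity
      fun y => ENNReal.ofReal (Real.exp ((b - a) * y - (b - a) ^ 2 / 2)) := by
    rw [← gaussianReal_eq_withDensity]
    simpa using ProbabilityTheory.gaussianReal_map_add_const (μ := 0) (v := 1) (b - a)
  rw [halfLineGaussian, halfLineGaussian, ProbabilityTheory.cond, ProbabilityTheory.cond,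
    Measure.map_smul, ← hpre, ← MeasurableEquiv.restrict_map, hpre, hmap,
    restrict_withDensity measurableSet_Ici, withDensity_smul_measure]
  simp_rw [mul_assoc, ENNReal.ofReal_mul (inv_nonneg.2 (hpos a).le),
    ENNReal.ofReal_mul (hpos b).le, ← mul_assoc]
  have hsm := withDensity_smul (μ := γ.restrict (Set.Ici b)) (ENNReal.ofReal (γ.real (Set.Ici a))⁻¹ *
    ENNReal.ofReal (γ.real (Set.Ici b)))
    (f := fun y => ENNReal.ofReal (Real.exp ((b - a) * y - (b - a) ^ 2 / 2))) (by fun_prop)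
  simp only [Pi.smul_def, smul_eq_mul] at hsm
  rw [hsm, smul_smul, ENNReal.ofReal_inv_of_pos (hpos a), ← hof, ← hof, mul_comm, mul_assoc,
    ENNReal.mul_inv_cancel (gaussianReal_Ici_ne_zero b) (measure_ne_top _ _), mul_one]

theorem infinitePi_withDensity {q : ℕ → Measure ℝ} [∀ n, IsProbabilityMeasure (q n)]
    {d : ℕ → ℝ → ENNReal} (hd : ∀ n, Measurable (d n))
    [∀ n, IsProbabilityMeasure ((q n).withDensity (d n))] {N : ℕ} (hN : ∀ n, N ≤ n → d n = 1) :
    Measure.infinitePi (fun n => (q n).withDensity (d n)) =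
      (Measure.infinitePi q).withDensity fun y => ∏ n ∈ Finset.range N, d n (y n) := by
  classical
  refine (Measure.eq_infinitePi _ fun u t ht => ?_).symm
  let g : ℕ → ℝ → ENNReal := fun n => (if n ∈ u then t n else Set.univ).indicator (d n)
  have hm : ∀ n, MeasurableSet (if n ∈ u then t n else Set.univ) := fun n => by
    split_ifs <;> simp [ht]
  have hg : ∀ n, Measurable (g n) := fun n => (hd n).indicator (hm n)
  have hbox : MeasurableSet ((u : Set ℕ).pi t) := .pi u.countable_toSet fun i _ => ht i
  have hprod : ∀ y : ℕ → ℝ, ((u : Set ℕ).pi t).indicator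
      (fun y => ∏ n ∈ Finset.range N, d n (y n)) y =
      ∏ n ∈ Finset.range N ∪ u, g n (y n) := fun y => by
    by_cases hy : y ∈ (u : Set ℕ).pi t
    · rw [Set.indicator_of_mem hy]
      have : ∀ n, g n (y n) = d n (y n) := fun n => by
        refine Set.indicator_of_mem ?_ _
        split_ifs with h
        · exact hy n h
        · trivial
      simp_rw [this]
      refine Finset.prod_subset Finset.subset_union_left fun n _ hn => ?_
      rw [hN n (by simpa using hn), Pi.one_apply]
    · rw [Set.indicator_of_notMem hy]
      simp only [Set.mem_pi, not_forall] at hy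
      obtain ⟨n, hn, hy⟩ := hy
      refine (Finset.prod_eq_zero (Finset.mem_union_right _ hn) ?_).symm
      refine Set.indicator_of_notMem ?_ _
      rwa [if_pos (Finset.mem_coe.1 hn)]
  rw [withDensity_apply _ hbox, ← lintegral_indicator hbox]
  simp_rw [hprod]
  rw [ProbabilityTheory.lintegral_prod_eq_prod_lintegral_of_indepFun _ (fun n (y : ℕ → ℝ) => g n (y n))
    (ProbabilityTheory.iIndepFun_infinitePi hg) (fun n => (hg n).comp (measurable_pi_apply n))]
  have hfac : ∀ n, ∫⁻ y, g n (y n) ∂Measure.infinitePi q =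
      (q n).withDensity (d n) (if n ∈ u then t n else Set.univ) := fun n => by
    rw [withDensity_apply _ (hm n), ← lintegral_indicator (hm n)]
    exact (measurePreserving_eval_infinitePi q n).lintegral_comp (hg n)
  simp_rw [hfac]
  rw [← Finset.prod_subset Finset.subset_union_right]
  · exact Finset.prod_congr rfl fun n hn => by rw [if_pos hn]
  · intro n _ hn
    rw [if_neg hn, measure_univ]

theorem IsGaussianProduct.eq_infinitePi {μ : Measure (ℕ → ℝ)} (hμ : IsGaussianProduct μ) :
    μ = Measure.infinitePi fun _ => ProbabilityTheory.gaussianReal 0 1 := by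
  classical
  refine Measure.eq_infinitePi _ fun u t ht => ?_
  obtain ⟨k, hk⟩ : ∃ k, u ⊆ Finset.range k := Finset.exists_nat_subset_range u
  have := hμ.2 k (fun n => if n ∈ u then t n else Set.univ)
    (fun n => by split_ifs <;> simp [ht])
    (fun n hn => if_neg fun h => by have := hk h; simp at this; omega)
  have hset : {y : ℕ → ℝ | ∀ n, y n ∈ if n ∈ u then t n else Set.univ} = (u : Set ℕ).pi t := by
    ext y
    simp only [Set.mem_ofPred_eq, Set.mem_pi, Finset.mem_coe]
    refine forall_congr' fun n => ?_
    by_cases h : n ∈ u <;> simp [h]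
  rw [hset] at this
  rw [this, ← Finset.prod_subset hk]
  · exact Finset.prod_congr rfl fun n hn => by rw [if_pos hn]
  · intro n _ hn
    rw [if_neg hn, measure_univ]

/-- Translations by finitely supported sequences preserve null sets of the Gaussian product. -/
theorem quasiMeasurePreserving_sub_infinitePi {x : ℕ → ℝ} {k : ℕ} (hx : ∀ n, k ≤ n → x n = 0) :
    Measure.QuasiMeasurePreserving (fun (y : ℕ → ℝ) n => y n - x n)
      (Measure.infinitePi fun _ => ProbabilityTheory.gaussianReal 0 1)
      (Measure.infinitePi fun _ => ProbabilityTheory.gaussianReal 0 1) := by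
  refine ⟨by fun_prop, ?_⟩
  have hmap : ∀ n, (ProbabilityTheory.gaussianReal 0 1).map (fun y => y - x n) =
      (ProbabilityTheory.gaussianReal 0 1).withDensity
        fun y => ENNReal.ofReal (Real.exp (-x n * y - (-x n) ^ 2 / 2)) := fun n => by
    rw [← gaussianReal_eq_withDensity, ProbabilityTheory.gaussianReal_map_sub_const, zero_sub]
  have : ∀ n, IsProbabilityMeasure ((ProbabilityTheory.gaussianReal 0 1).withDensity
      fun y => ENNReal.ofReal (Real.exp (-x n * y - (-x n) ^ 2 / 2))) := fun n => by
    rw [← gaussianReal_eq_withDensity]; infer_instance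
  rw [Measure.infinitePi_map_pi (μ := fun _ => ProbabilityTheory.gaussianReal 0 1)
    (f := fun n y => y - x n) (fun n => by fun_prop)]
  simp_rw [hmap]
  rw [infinitePi_withDensity (fun n => by fun_prop) (N := k)
    (fun n hn => by ext; simp [hx n hn])]
  exact withDensity_absolutelyContinuous _ _

/-- Restricting the Gaussian product to an infinite box of positive measure gives, up to
normalization, the product of the conditioned Gaussians. -/
theorem restrict_infinitePi_gaussian {a : ℕ → ℝ} {L : ℝ}
    (hL : Tendsto (fun N : ℕ => ∏ n ∈ Finset.range N,
      (ProbabilityTheory.gaussianReal 0 1 (Set.Ici (a n))).toReal) atTop (𝓝 L)) (hpos : 0 < L) :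
    (Measure.infinitePi fun _ => ProbabilityTheory.gaussianReal 0 1).restrict
        {y : ℕ → ℝ | ∀ n, a n ≤ y n} =
      ENNReal.ofReal L • Measure.infinitePi fun n => halfLineGaussian (a n) := by
  classical
  set γ := ProbabilityTheory.gaussianReal 0 1 with hγ
  have hL' : Tendsto (fun N : ℕ => ∏ n ∈ Finset.range N, γ (Set.Ici (a n))) atTop
      (𝓝 (ENNReal.ofReal L)) := by
    refine (ENNReal.tendsto_ofReal hL).congr fun N => ?_
    rw [ENNReal.ofReal_prod_of_nonneg fun _ _ => ENNReal.toReal_nonneg]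
    exact Finset.prod_congr rfl fun n _ => ENNReal.ofReal_toReal (measure_ne_top _ _)
  have hne : ENNReal.ofReal L ≠ 0 := by simpa using hpos
  have hkey : (ENNReal.ofReal L)⁻¹ • (Measure.infinitePi fun _ => γ).restrict
      {y : ℕ → ℝ | ∀ n, a n ≤ y n} = Measure.infinitePi fun n => halfLineGaussian (a n) := by
    refine Measure.eq_infinitePi _ fun u t ht => ?_
    let s : ℕ → Set ℝ := fun n => Set.Ici (a n) ∩ if n ∈ u then t n else Set.univ
    have hs : ∀ n, MeasurableSet (s n) := fun n => by
      refine measurableSet_Ici.inter ?_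
      split_ifs <;> simp [ht]
    have hset : (u : Set ℕ).pi t ∩ {y : ℕ → ℝ | ∀ n, a n ≤ y n} = Set.univ.pi s := by
      ext y
      simp only [s, Set.mem_inter_iff, Set.mem_pi, Set.mem_ofPred_eq, Finset.mem_coe, Set.mem_univ,
        forall_true_left, Set.mem_Ici]
      rw [and_comm, ← forall_and]
      refine forall_congr' fun n => ?_
      by_cases h : n ∈ u <;> simp [h]
    have hfac : ∀ n, γ (s n) =
        γ (Set.Ici (a n)) * if n ∈ u then halfLineGaussian (a n) (t n) else 1 := fun n => by
      split_ifs with h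
      · rw [halfLineGaussian_apply, ← mul_assoc, ENNReal.mul_inv_cancel
          (gaussianReal_Ici_ne_zero _) (measure_ne_top _ _), one_mul]
        simp [s, h, hγ]
      · simp [s, h]
    have hlim : Tendsto (fun N => ∏ n ∈ Finset.range N, γ (s n)) atTop
        (𝓝 (ENNReal.ofReal L * ∏ n ∈ u, halfLineGaussian (a n) (t n))) := by
      have h2 := ENNReal.Tendsto.mul_const (b := ∏ n ∈ u, halfLineGaussian (a n) (t n)) hL'
        (Or.inl hne)
      refine h2.congr' ?_
      obtain ⟨k, hk⟩ : ∃ k, u ⊆ Finset.range k := Finset.exists_nat_subset_range u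
      filter_upwards [eventually_ge_atTop k] with N hkN
      simp_rw [hfac, Finset.prod_mul_distrib]
      congr 1
      rw [Finset.prod_ite_mem, Finset.inter_eq_right.2 (hk.trans (Finset.range_mono hkN))]
    have hlim' : Tendsto (fun N => ∏ n ∈ Finset.range N, γ (s n)) atTop
        (𝓝 ((Measure.infinitePi fun _ => γ) (Set.univ.pi s))) := by
      rw [Measure.infinitePi_pi_univ _ hs]
      exact (ENNReal.multipliable_of_le_one fun n => prob_le_one).tendsto_prod_tprod_nat
    rw [Measure.smul_apply, Measure.restrict_apply (.pi u.countable_toSet fun i _ => ht i), hset,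
      tendsto_nhds_unique hlim' hlim, smul_eq_mul, ← mul_assoc,
      ENNReal.inv_mul_cancel hne ENNReal.ofReal_ne_top, one_mul]
  rw [← hkey, smul_smul, ENNReal.mul_inv_cancel hne ENNReal.ofReal_ne_top, one_smul]

/-- Weighted composition with a measurable equivalence is a unitary between `L²` spaces when the
square of the weight is the density of the image measure. -/
theorem exists_linearIsometryEquiv_weighted_comp {X Y : Type*} [MeasurableSpace X]
    [MeasurableSpace Y] {m₁ : Measure X} {m₂ : Measure Y} (e : X ≃ᵐ Y) {ρ : Y → ℝ}
    (hρ : Measurable ρ) (hpos : ∀ y, 0 < ρ y)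
    (hmap : m₁.map e = m₂.withDensity fun y => ENNReal.ofReal (ρ y ^ 2)) :
    Measure.QuasiMeasurePreserving e.symm m₂ m₁ ∧
    ∃ W : Lp ℂ 2 m₁ ≃ₗᵢ[ℂ] Lp ℂ 2 m₂,
      ∀ f : Lp ℂ 2 m₁, W f =ᵐ[m₂] fun y => (ρ y : ℂ) * f (e.symm y) := by
  have hdm : Measurable fun y => ENNReal.ofReal (ρ y ^ 2) := by fun_prop
  have hq : Measure.QuasiMeasurePreserving e.symm m₂ m₁ := by
    refine ⟨e.symm.measurable, ?_⟩
    have hac : m₂ ≪ m₁.map e := by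
      rw [hmap]
      exact withDensity_absolutelyContinuous' hdm.aemeasurable
        (ae_of_all _ fun y => by simpa using (hpos y).ne')
    have := hac.map e.symm.measurable
    rwa [Measure.map_map e.symm.measurable e.measurable, MeasurableEquiv.symm_comp_self,
      Measure.map_id] at this
  have hq' : Measure.QuasiMeasurePreserving e m₁ m₂ :=
    ⟨e.measurable, hmap ▸ withDensity_absolutelyContinuous _ _⟩
  have hρc : Measurable fun y => (ρ y : ℂ) := by fun_prop
  have hnorm : ∀ f : X → ℂ, eLpNorm (fun y => (ρ y : ℂ) * f (e.symm y)) 2 m₂ =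
      eLpNorm f 2 m₁ := fun f => by
    rw [eLpNorm_eq_lintegral_rpow_enorm_toReal two_ne_zero ENNReal.ofNat_ne_top,
      eLpNorm_eq_lintegral_rpow_enorm_toReal two_ne_zero ENNReal.ofNat_ne_top]
    congr 1
    have h1 := lintegral_map_equiv (μ := m₁)
      (fun y => ‖f (e.symm y)‖ₑ ^ (2 : ENNReal).toReal) e
    simp only [MeasurableEquiv.symm_apply_apply] at h1
    rw [← h1, hmap, lintegral_withDensity_eq_lintegral_mul_non_measurable _ hdm (by simp)]
    refine lintegral_congr fun y => ?_
    rw [Pi.mul_apply, enorm_mul, ENNReal.mul_rpow_of_nonneg _ _ (by simp)]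
    congr 1
    rw [← ofReal_norm, Complex.norm_real, Real.norm_of_nonneg (hpos y).le]
    simp [ENNReal.ofReal_pow (hpos y).le]
  have hmem : ∀ f : Lp ℂ 2 m₁, MemLp (fun y => (ρ y : ℂ) * f (e.symm y)) 2 m₂ := fun f =>
    ⟨hρc.aestronglyMeasurable.mul ((Lp.aestronglyMeasurable f).comp_quasiMeasurePreserving hq),
      by rw [hnorm]; exact Lp.eLpNorm_lt_top f⟩
  let W : Lp ℂ 2 m₁ →ₗᵢ[ℂ] Lp ℂ 2 m₂ :=
    { toFun := fun f => (hmem f).toLp _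
      map_add' := fun f g => by
        rw [← MemLp.toLp_add]
        refine MemLp.toLp_congr _ _ ?_
        filter_upwards [hq.ae (Lp.coeFn_add f g)] with y hy
        rw [hy, Pi.add_apply, Pi.add_apply, mul_add]
      map_smul' := fun c f => by
        rw [RingHom.id_apply, ← MemLp.toLp_const_smul]
        refine MemLp.toLp_congr _ _ ?_
        filter_upwards [hq.ae (Lp.coeFn_smul c f)] with y hy
        rw [hy, Pi.smul_apply, Pi.smul_apply, smul_eq_mul, smul_eq_mul, mul_left_comm]
      norm_map' := fun f => by
        change ‖(hmem f).toLp _‖ = ‖f‖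
        rw [Lp.norm_toLp, hnorm, Lp.norm_def] }
  have hW : ∀ f, W f =ᵐ[m₂] fun y => (ρ y : ℂ) * f (e.symm y) := fun f => (hmem f).coeFn_toLp
  have hsurj : Function.Surjective W := fun g => by
    let f₀ : X → ℂ := fun x => (ρ (e x) : ℂ)⁻¹ * g (e x)
    have hinv : (fun y => (ρ y : ℂ) * f₀ (e.symm y)) = g := by
      ext y
      simp only [f₀, MeasurableEquiv.apply_symm_apply]
      exact mul_inv_cancel_left₀ (by exact_mod_cast (hpos y).ne') _
    have hf₀ : MemLp f₀ 2 m₁ := by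
      refine ⟨(hρc.comp e.measurable).inv.aestronglyMeasurable.mul
        ((Lp.aestronglyMeasurable g).comp_quasiMeasurePreserving hq'), ?_⟩
      rw [← hnorm, hinv]
      exact Lp.eLpNorm_lt_top g
    refine ⟨hf₀.toLp _, Lp.ext ((hW _).trans ?_)⟩
    filter_upwards [hq.ae hf₀.coeFn_toLp] with y hy
    rw [hy]
    exact congrFun hinv y
  exact ⟨hq, LinearIsometryEquiv.ofSurjective W hsurj, hW⟩

/-- The conditionings of the Gaussian measure on `[a, ∞)` and `[b, ∞)` are related by translation,
up to a density, and also by a measure-preserving monotone transport. -/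
theorem exists_coordinate_equiv (a b : ℝ) (p : Prop) [Decidable p] :
    ∃ (e : ℝ ≃ᵐ ℝ) (c : ℝ), 0 < c ∧ (∀ y, b ≤ e y ↔ a ≤ y) ∧
      (p → e = MeasurableEquiv.addRight (b - a)) ∧
      (halfLineGaussian a).map e = (halfLineGaussian b).withDensity
        (if p then fun y => ENNReal.ofReal (c * Real.exp ((b - a) * y - (b - a) ^ 2 / 2))
          else 1) := by
  by_cases hp : p
  · obtain ⟨c, hc, hmap⟩ := map_add_halfLineGaussian a b
    refine ⟨_, c, hc, fun y => ?_, fun _ => rfl, by rw [if_pos hp, hmap]⟩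
    rw [MeasurableEquiv.coe_addRight]
    constructor <;> intro h <;> linarith
  · obtain ⟨e, he, hmap⟩ := exists_measurableEquiv_map_halfLineGaussian a b
    exact ⟨e, 1, one_pos, he, fun h => (hp h).elim, by rw [if_neg hp, hmap, withDensity_one]⟩

/-- for every `N`, there is a unitary `W : L²(A) → L²(B)` intertwining
`V^A_x` and `V^B_x` for every `x ∈ ℝ₊^∞` supported in the first `N` coordinates — even when
`Σ (a_n - b_n)² = ∞`, in which case `V^A` and `V^B` are not unitarily equivalent. -/
theorem stmt_18 (μ : Measure (ℕ → ℝ)) (hμ : IsGaussianProduct μ)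
    (a b : ℕ → ℝ) (ha : ∀ n, a n ≤ 0) (hb : ∀ n, b n ≤ 0)
    (hproda : ∃ L : ℝ, 0 < L ∧
      Tendsto (fun N : ℕ => ∏ n ∈ Finset.range N,
          (ProbabilityTheory.gaussianReal 0 1 (Set.Ici (a n))).toReal) atTop (𝓝 L))
    (hprodb : ∃ L : ℝ, 0 < L ∧
      Tendsto (fun N : ℕ => ∏ n ∈ Finset.range N,
          (ProbabilityTheory.gaussianReal 0 1 (Set.Ici (b n))).toReal) atTop (𝓝 L))
    (A : Set (ℕ → ℝ)) (hA : A = {y : ℕ → ℝ | ∀ n, a n ≤ y n})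
    (B : Set (ℕ → ℝ)) (hB : B = {y : ℕ → ℝ | ∀ n, b n ≤ y n})
    (VA : (ℕ → NNReal) → (Lp ℂ 2 (μ.restrict A) →L[ℂ] Lp ℂ 2 (μ.restrict A)))
    (hVA : IsGaussianShiftRep μ A VA)
    (VB : (ℕ → NNReal) → (Lp ℂ 2 (μ.restrict B) →L[ℂ] Lp ℂ 2 (μ.restrict B)))
    (hVB : IsGaussianShiftRep μ B VB)
    (N : ℕ) :
    ∃ W : Lp ℂ 2 (μ.restrict A) ≃ₗᵢ[ℂ] Lp ℂ 2 (μ.restrict B),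
      ∀ x : ℕ → NNReal, (∀ i, N ≤ i → x i = 0) →
        ∀ f : Lp ℂ 2 (μ.restrict A), W (VA x f) = VB x (W f) := by
  classical
  obtain ⟨La, hLa, hta⟩ := hproda
  obtain ⟨Lb, hLb, htb⟩ := hprodb
  choose e c hc hord htrans hmap using fun n => exists_coordinate_equiv (a n) (b n) (n < N)
  have hμeq := hμ.eq_infinitePi
  set d : ℕ → ℝ → ENNReal := fun n => if n < N then
    fun y => ENNReal.ofReal (c n * Real.exp ((b n - a n) * y - (b n - a n) ^ 2 / 2)) else 1 with hd
  have hdm : ∀ n, Measurable (d n) := fun n => by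
    simp only [hd]
    split_ifs <;> fun_prop
  have hdp : ∀ n, IsProbabilityMeasure ((halfLineGaussian (b n)).withDensity (d n)) := fun n => by
    rw [← hmap]
    exact Measure.isProbabilityMeasure_map (e n).measurable.aemeasurable
  let Φ : (ℕ → ℝ) ≃ᵐ (ℕ → ℝ) := MeasurableEquiv.piCongrRight e
  let E : (ℕ → ℝ) → ℝ := fun y =>
    ∑ n ∈ Finset.range N, ((b n - a n) * y n - (b n - a n) ^ 2 / 2) / 2
  set K : ℝ := La / Lb * ∏ n ∈ Finset.range N, c n with hK
  have hKpos : 0 < K := mul_pos (div_pos hLa hLb) (Finset.prod_pos fun n _ => hc n)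
  let ρ : (ℕ → ℝ) → ℝ := fun y => Real.sqrt K * Real.exp (E y)
  have hρm : Measurable ρ := by fun_prop
  have hρpos : ∀ y, 0 < ρ y := fun y => mul_pos (Real.sqrt_pos.2 hKpos) (Real.exp_pos _)
  have hρsq : ∀ y, ENNReal.ofReal (ρ y ^ 2) =
      ENNReal.ofReal (La / Lb) * ∏ n ∈ Finset.range N, d n (y n) := fun y => by
    have hprod : ∏ n ∈ Finset.range N, d n (y n) = ENNReal.ofReal (∏ n ∈ Finset.range N,
        (c n * Real.exp ((b n - a n) * y n - (b n - a n) ^ 2 / 2))) := by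
      rw [ENNReal.ofReal_prod_of_nonneg fun n _ => (mul_pos (hc n) (Real.exp_pos _)).le]
      exact Finset.prod_congr rfl fun n hn => by
        simp only [hd]; rw [if_pos (Finset.mem_range.1 hn)]
    rw [hprod, ← ENNReal.ofReal_mul (div_pos hLa hLb).le, mul_pow, Real.sq_sqrt hKpos.le,
      Finset.prod_mul_distrib, ← Real.exp_sum, ← Real.exp_nat_mul, hK, mul_assoc]
    simp only [E, ← Finset.sum_div]
    congr 4
    push_cast
    ring
  have hΦ : (μ.restrict A).map Φ =
      (μ.restrict B).withDensity fun y => ENNReal.ofReal (ρ y ^ 2) := by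
    have hpi : (Measure.infinitePi fun n => halfLineGaussian (a n)).map Φ =
        (Measure.infinitePi fun n => halfLineGaussian (b n)).withDensity
          fun y => ∏ n ∈ Finset.range N, d n (y n) := by
      rw [← infinitePi_withDensity hdm fun n hn => by simp only [hd]; rw [if_neg hn.not_gt]]
      exact (Measure.infinitePi_map_pi (μ := fun n => halfLineGaussian (a n))
        (f := fun n => e n) fun n => (e n).measurable).trans
          (congrArg Measure.infinitePi (funext hmap))
    have hm : Measurable fun y : ℕ → ℝ => ∏ n ∈ Finset.range N, d n (y n) :=
      Finset.measurable_prod _ fun n _ => (hdm n).comp (measurable_pi_apply n)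
    have hsm := withDensity_smul (μ := Measure.infinitePi fun n => halfLineGaussian (b n))
      (ENNReal.ofReal (La / Lb)) hm
    have hρd : (fun y => ENNReal.ofReal (ρ y ^ 2)) =
        ENNReal.ofReal (La / Lb) • fun y => ∏ n ∈ Finset.range N, d n (y n) := funext hρsq
    rw [hρd]
    rw [hμeq, hA, hB, restrict_infinitePi_gaussian hta hLa, restrict_infinitePi_gaussian htb hLb,
      Measure.map_smul, hpi, withDensity_smul_measure, hsm, smul_smul,
      ← ENNReal.ofReal_mul hLb.le, mul_div_cancel₀ _ hLb.ne']
  obtain ⟨hq, W, hW⟩ := exists_linearIsometryEquiv_weighted_comp Φ hρm hρpos hΦ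
  refine ⟨W, fun x hx f => Lp.ext ?_⟩
  have hBm : MeasurableSet B := by
    rw [hB, Set.ofPred_forall]
    exact MeasurableSet.iInter fun n => measurableSet_le measurable_const (measurable_pi_apply n)
  have hshift : Measure.QuasiMeasurePreserving (fun (y : ℕ → ℝ) n => y n - (x n : ℝ)) μ μ := by
    rw [hμeq]
    exact quasiMeasurePreserving_sub_infinitePi (k := N) fun n hn => by simp [hx n hn]
  have hWshift : ∀ᵐ y ∂μ.restrict B, (fun n => y n - (x n : ℝ)) ∈ B →
      W f (fun n => y n - (x n : ℝ)) = (ρ fun n => y n - (x n : ℝ)) *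
        f (Φ.symm fun n => y n - (x n : ℝ)) :=
    ae_restrict_of_ae (hshift.ae ((ae_restrict_iff' hBm).1 (hW f)))
  have hsymm : ∀ y : ℕ → ℝ, (Φ.symm fun n => y n - (x n : ℝ)) =
      fun n => Φ.symm y n - (x n : ℝ) := fun y => by
    funext n
    change (e n).symm (y n - x n) = (e n).symm (y n) - x n
    rcases lt_or_ge n N with hn | hn
    · rw [MeasurableEquiv.symm_apply_eq, htrans n hn, MeasurableEquiv.coe_addRight]
      have := (e n).apply_symm_apply (y n)
      rw [htrans n hn, MeasurableEquiv.coe_addRight] at this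
      linarith
    · simp [hx n hn]
  have hmemΦ : ∀ z, Φ.symm z ∈ A ↔ z ∈ B := fun z => by
    rw [hA, hB]
    refine forall_congr' fun n => ?_
    change a n ≤ (e n).symm (z n) ↔ _
    rw [← hord, (e n).apply_symm_apply]
  have hsqrt : ∀ y : ℕ → ℝ, Real.sqrt (∏ n ∈ Finset.range N,
      Real.exp ((2 * (x n : ℝ) * y n - (x n : ℝ) ^ 2) / 2)) =
      Real.exp (∑ n ∈ Finset.range N, (2 * (x n : ℝ) * y n - (x n : ℝ) ^ 2) / 4) := fun y => by
    rw [← Real.exp_sum, ← Real.exp_half, Finset.sum_div]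
    congr 1
    exact Finset.sum_congr rfl fun n _ => by ring
  have hcocycle : ∀ y, ρ y * Real.exp (∑ n ∈ Finset.range N,
      (2 * (x n : ℝ) * Φ.symm y n - (x n : ℝ) ^ 2) / 4) =
      Real.exp (∑ n ∈ Finset.range N, (2 * (x n : ℝ) * y n - (x n : ℝ) ^ 2) / 4) *
        ρ fun n => y n - (x n : ℝ) := fun y => by
    simp only [ρ, E]
    rw [mul_assoc, ← Real.exp_add, mul_left_comm, ← Real.exp_add, ← Finset.sum_add_distrib,
      ← Finset.sum_add_distrib]
    congr 2
    refine Finset.sum_congr rfl fun n hn => ?_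
    have hy : Φ.symm y n = y n - (b n - a n) := by
      change (e n).symm (y n) = _
      rw [MeasurableEquiv.symm_apply_eq, htrans n (Finset.mem_range.1 hn),
        MeasurableEquiv.coe_addRight]
      ring
    rw [hy]
    ring
  filter_upwards [hW (VA x f), hq.ae (hVA.2 x N hx f), hVB.2 x N hx (W f), hWshift]
    with y h1 h2 h3 h4
  rw [h1, h2, h3]
  by_cases hy : (fun n => y n - (x n : ℝ)) ∈ B
  · have hy' : (fun n => Φ.symm y n - (x n : ℝ)) ∈ A := by rwa [← hsymm, hmemΦ]
    rw [Set.indicator_of_mem (by exact hy'), Set.indicator_of_mem (by exact hy), h4 hy, hsqrt,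
      hsqrt, hsymm, ← mul_assoc, ← mul_assoc, ← Complex.ofReal_mul, ← Complex.ofReal_mul,
      hcocycle]
  · have hy' : (fun n => Φ.symm y n - (x n : ℝ)) ∉ A := by rwa [← hsymm, hmemΦ]
    rw [Set.indicator_of_notMem (by exact hy'), Set.indicator_of_notMem (by exact hy), mul_zero]
end

section
/- (Failure of Wold decomposition for ℝ₊^∞.) There exist a nonzero separable complex Hilbert space H and a doubly commuting isometric representation V = (V_x)_{x∈ℝ₊^∞} of ℝ₊^∞ on H, strongly continuous on each finite block (for every n and every ξ ∈ H, the map ℝ₊^n ∋ t ↦ V_{(t_1,…,t_n,0,0,…)} ξ is continuous), which admits no Wold decomposition: there is no family (H_g)_{g ∈ {0,1}^ℕ} of pairwise orthogonal closed subspaces of H whose closed linear span is H, with each H_g reducing for V (V_x H_g ⊆ H_g and V_x* H_g ⊆ H_g for all x ∈ ℝ₊^∞), and such that for every g ∈ {0,1}^ℕ and every i ∈ ℕ: if g(i) = 0 then V_{t e_i} H_g = H_g for all t ≥ 0 (the restriction of (V_{t e_i})_{t≥0} to H_g is unitary), and if g(i) = 1 then V_{t e_i}* ξ → 0 as t → ∞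 for every ξ ∈ H_g (the restriction is pure). -/
open ContinuousLinearMap Filter Topology
open scoped InnerProductSpace

/-- `x : ℕ → ℝ≥0` belongs to `ℝ₊^∞`, i.e. has only finitely many nonzero coordinates. -/
def FinSupp (x : ℕ → NNReal) : Prop := ∃ k : ℕ, ∀ n, k ≤ n → x n = 0

open scoped ComplexOrder in
theorem exists_hilbert_of_posSemidef {X : Type} (k : X → X → ℝ)
    (hk : (Matrix.of fun x y => (k x y : ℂ)).PosSemidef) :
    ∃ (H : Type) (_ : NormedAddCommGroup H) (_ : InnerProductSpace ℂ H) (_ : CompleteSpace H)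
      (e : X → H), (∀ x y, ⟪e x, e y⟫_ℂ = k x y) ∧
        (Submodule.span ℂ (Set.range e)).topologicalClosure = ⊤ := by
  let K : Matrix X X (ℂ →L[ℂ] ℂ) := Matrix.of fun x y => (k x y : ℂ) • ContinuousLinearMap.id ℂ ℂ
  have symm : ∀ x y, k x y = k y x := fun x y => by
    have := hk.1.apply x y
    simpa using this.symm
  have hK : K.PosSemidef := by
    have tfae := (RKHS.posSemidef_tfae (K := K)).out 0 2
    refine tfae.mpr ⟨?_, fun v => ?_⟩
    · ext x y
      have h1 : adjoint (ContinuousLinearMap.id ℂ ℂ) = ContinuousLinearMap.id ℂ ℂ := star_one _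
      simp [K, Matrix.conjTranspose_apply, ContinuousLinearMap.star_eq_adjoint, symm y x, h1]
    · have h := (Complex.le_def.mp (hk.2 v)).1
      simp only [Complex.zero_re] at h
      convert h using 2
      refine congrArg Complex.re (Finsupp.sum_congr fun x _ => Finsupp.sum_congr fun y _ => ?_)
      simp [K, symm y x]
      ring
  have : Fact K.PosSemidef := ⟨hK⟩
  refine ⟨RKHS.OfKernel K, inferInstance, inferInstance, inferInstance,
    fun x => RKHS.kerFun (RKHS.OfKernel K) x 1, fun x y => ?_, ?_⟩
  · rw [← RKHS.kernel_inner, RKHS.OfKernel.kernel_ofKernel]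
    simp [K, symm x y]
  · rw [← top_le_iff, ← RKHS.kerFun_dense (RKHS.OfKernel K)]
    refine Submodule.topologicalClosure_mono (Submodule.span_le.mpr ?_)
    rintro _ ⟨x, v, rfl⟩
    have : RKHS.kerFun (RKHS.OfKernel K) x v = v • RKHS.kerFun (RKHS.OfKernel K) x 1 := by
      rw [← map_smul]; simp
    rw [this]
    exact Submodule.smul_mem _ _ (Submodule.subset_span ⟨x, rfl⟩)

theorem exists_isometry_of_kernel {X H : Type} [NormedAddCommGroup H] [InnerProductSpace ℂ H]
    [CompleteSpace H] {k : X → X → ℝ} {e : X → H} (he : ∀ x y, ⟪e x, e y⟫_ℂ = k x y)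
    (hd : (Submodule.span ℂ (Set.range e)).topologicalClosure = ⊤)
    (φ : X → X) (hφ : ∀ x y, k (φ x) (φ y) = k x y) :
    ∃ V : H →L[ℂ] H, (∀ x, V (e x) = e (φ x)) ∧ ∀ ξ, ‖V ξ‖ = ‖ξ‖ := by
  let E : (X →₀ ℂ) →ₗ[ℂ] H := Finsupp.linearCombination ℂ e
  let F : (X →₀ ℂ) →ₗ[ℂ] H := Finsupp.linearCombination ℂ (e ∘ φ)
  have hE : DenseRange E := by
    have : (LinearMap.range E).topologicalClosure = ⊤ := by
      rw [Finsupp.range_linearCombination]; exact hd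
    rw [DenseRange, dense_iff_closure_eq]
    simpa [LinearMap.coe_range] using congrArg (fun S : Submodule ℂ H => (S : Set H)) this
  have hn : ∀ c, ‖F c‖ = ‖E c‖ := fun c => by
    have : ⟪F c, F c⟫_ℂ = ⟪E c, E c⟫_ℂ := by
      simp only [E, F, Finsupp.linearCombination_apply, Finsupp.sum_inner, Finsupp.inner_sum,
        inner_smul_left, inner_smul_right, Function.comp_apply, he, hφ]
    rw [← sq_eq_sq₀ (norm_nonneg _) (norm_nonneg _), ← inner_self_eq_norm_sq (𝕜 := ℂ), this,
      inner_self_eq_norm_sq]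
  have hb : ∃ C, ∀ c, ‖F c‖ ≤ C * ‖E c‖ := ⟨1, fun c => by simp [hn]⟩
  refine ⟨F.extendOfNorm E, fun x => ?_, fun ξ => ?_⟩
  · have := LinearMap.extendOfNorm_eq hE hb (Finsupp.single x 1)
    simpa [E, F] using this
  · refine hE.induction_on (p := fun ξ => ‖F.extendOfNorm E ξ‖ = ‖ξ‖) ξ
      (isClosed_eq (by fun_prop) (by fun_prop)) fun c => ?_
    rw [LinearMap.extendOfNorm_eq hE hb, hn]

theorem eq_of_inner_total {X H : Type} [NormedAddCommGroup H] [InnerProductSpace ℂ H]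
    {e : X → H} (hd : (Submodule.span ℂ (Set.range e)).topologicalClosure = ⊤)
    {u v : H} (h : ∀ x, ⟪u, e x⟫_ℂ = ⟪v, e x⟫_ℂ) : u = v := by
  refine (Submodule.dense_iff_topologicalClosure_eq_top.mpr hd).eq_of_inner_left (𝕜 := ℂ) fun w hw => ?_
  induction hw using Submodule.span_induction with
  | mem x hx => obtain ⟨x, rfl⟩ := hx; exact h x
  | zero => simp
  | add x y _ _ hx hy => simp [inner_add_right, hx, hy]
  | smul a x _ hx => simp [inner_smul_right, hx]

/-- The label `(p, q, s)` of the vector `p ⊕ q S_s ω` of `ℂ ⊕ L²(ℝ₊)`, where `ω(y) = √2 e^{-y}`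
and `S` is the shift semigroup. -/
abbrev Label : Type := ℝ × ℝ × NNReal

/-- Half the inner product of the vectors of `ℂ ⊕ L²(ℝ₊)` with the given labels. -/
noncomputable def labelKernel (a b : Label) : ℝ :=
  (a.1 * b.1 + a.2.1 * b.2.1 * Real.exp (-|(a.2.2 : ℝ) - b.2.2|)) / 2

/-- The label of the reference unit vector. -/
def vac : Label := (1, 1, 0)

/-- The labels of elementary tensors in the infinite tensor product of copies of
`ℂ ⊕ L²(ℝ₊)` along the reference vector. -/
abbrev Config : Type := {σ : ℕ → Label // ∃ N, ∀ n, N ≤ n → σ n = vac}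

/-- The inner product of elementary tensors. -/
noncomputable def configKernel (σ τ : Config) : ℝ := ∏ᶠ i, labelKernel (σ.1 i) (τ.1 i)

theorem labelKernel_vac : labelKernel vac vac = 1 := by
  norm_num [labelKernel, vac]

theorem labelKernel_comm (a b : Label) : labelKernel a b = labelKernel b a := by
  simp only [labelKernel, abs_sub_comm (a.2.2 : ℝ)]
  ring

theorem continuous_labelKernel : Continuous fun x : Label × Label => labelKernel x.1 x.2 := by
  unfold labelKernel
  fun_prop

theorem configKernel_comm (σ τ : Config) : configKernel σ τ = configKernel τ σ :=
  finprod_congr fun _ => labelKernel_comm _ _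

theorem configKernel_eq_prod {σ τ : Config} {s : Finset ℕ} (hσ : ∀ i, i ∉ s → σ.1 i = vac)
    (hτ : ∀ i, i ∉ s → τ.1 i = vac) :
    configKernel σ τ = ∏ i ∈ s, labelKernel (σ.1 i) (τ.1 i) := by
  refine finprod_eq_prod_of_mulSupport_subset _ fun i hi => ?_
  by_contra h
  exact hi (by simp only [hσ i h, hτ i h, labelKernel_vac])

theorem exp_neg_abs_sub (x y : ℝ) :
    Real.exp (-|x - y|) =
      Real.exp (-x) * Real.exp (-y) * min (Real.exp (2 * x)) (Real.exp (2 * y)) := by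
  rcases le_total x y with h | h
  · rw [min_eq_left (by gcongr), abs_of_nonpos (by linarith), ← Real.exp_add, ← Real.exp_add]
    ring_nf
  · rw [min_eq_right (by gcongr), abs_of_nonneg (by linarith), ← Real.exp_add, ← Real.exp_add]
    ring_nf

section PosSemidef

open scoped ComplexOrder

theorem posSemidef_gram_of_infinite {X E : Type} [NormedAddCommGroup E] [InnerProductSpace ℂ E]
    (v : X → E) : (Matrix.gram ℂ v).PosSemidef := by
  refine ⟨Matrix.isHermitian_gram ℂ v, fun x => ?_⟩
  have : (x.sum fun i xi => x.sum fun j xj => star xi * Matrix.gram ℂ v i j * xj) =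
      ⟪x.sum fun i xi => xi • v i, x.sum fun i xi => xi • v i⟫_ℂ := by
    rw [Finsupp.sum_comm]
    simp only [Finsupp.sum_inner, Finsupp.inner_sum, inner_smul_left, inner_smul_right,
      Matrix.gram_apply]
    refine Finsupp.sum_congr fun i _ => ?_
    rw [← smul_eq_mul, Finsupp.smul_sum]
    refine Finsupp.sum_congr fun j _ => ?_
    simp only [smul_eq_mul, RCLike.star_def]
    ring
  rw [this, inner_self_eq_norm_sq_to_K]
  norm_cast
  positivity

theorem posSemidef_mul_self {X : Type} (f : X → ℝ) :
    (Matrix.of fun x y => ((f x * f y : ℝ) : ℂ)).PosSemidef := by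
  have : (Matrix.of fun x y => ((f x * f y : ℝ) : ℂ)) = Matrix.gram ℂ fun x => (f x : ℂ) := by
    ext x y
    simp [Matrix.gram_apply, mul_comm]
  rw [this]
  exact posSemidef_gram_of_infinite _

theorem posSemidef_min {X : Type} (f : X → ℝ) (hf : ∀ x, 0 ≤ f x) :
    (Matrix.of fun x y => ((min (f x) (f y) : ℝ) : ℂ)).PosSemidef := by
  have : (Matrix.of fun x y => ((min (f x) (f y) : ℝ) : ℂ)) = Matrix.gram ℂ fun x =>
      MeasureTheory.indicatorConstLp 2 (μ := MeasureTheory.volume)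
        (measurableSet_Icc (a := (0 : ℝ)) (b := f x)) (by simp) (1 : ℂ) := by
    ext x y
    rw [Matrix.gram_apply, MeasureTheory.L2.inner_indicatorConstLp_indicatorConstLp _ _
      (by simp) (by simp)]
    simp [Set.Icc_inter_Icc, hf]
  rw [this]
  exact posSemidef_gram_of_infinite _

theorem posSemidef_labelKernel :
    (Matrix.of fun a b : Label => (labelKernel a b : ℂ)).PosSemidef := by
  have h := (posSemidef_mul_self fun a : Label => a.1 / √2).add
    ((posSemidef_mul_self fun a : Label => a.2.1 / √2 * Real.exp (-(a.2.2 : ℝ))).hadamard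
      (posSemidef_min (fun a : Label => Real.exp (2 * (a.2.2 : ℝ))) fun _ => (Real.exp_pos _).le))
  convert h using 1
  ext a b
  simp only [Matrix.add_apply, Matrix.hadamard_apply, Matrix.of_apply]
  rw [← Complex.ofReal_mul, ← Complex.ofReal_add, Complex.ofReal_inj, labelKernel, exp_neg_abs_sub]
  field_simp
  rw [Real.sq_sqrt zero_le_two]
  ring

theorem posSemidef_prod {X ι : Type} (s : Finset ι) (k : ι → X → X → ℝ)
    (hk : ∀ i, (Matrix.of fun x y => (k i x y : ℂ)).PosSemidef) :
    (Matrix.of fun x y => ((∏ i ∈ s, k i x y : ℝ) : ℂ)).PosSemidef := by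
  classical
  induction s using Finset.induction_on with
  | empty => simpa using posSemidef_mul_self fun _ : X => 1
  | insert i s hi ih =>
    have h : (Matrix.of fun x y => ((∏ i ∈ insert i s, k i x y : ℝ) : ℂ)) =
        (Matrix.of fun x y => (k i x y : ℂ)).hadamard
          (Matrix.of fun x y => ((∏ i ∈ s, k i x y : ℝ) : ℂ)) := by
      ext x y
      simp [Finset.prod_insert hi]
    rw [h]
    exact (hk i).hadamard ih

theorem posSemidef_configKernel :
    (Matrix.of fun σ τ : Config => (configKernel σ τ : ℂ)).PosSemidef := by
  refine ⟨?_, fun v => ?_⟩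
  · ext σ τ
    simp [configKernel_comm σ τ]
  · choose N hN using fun σ : Config => σ.2
    have hs : ∀ σ ∈ v.support, ∀ i, i ∉ Finset.range (v.support.sup N) → σ.1 i = vac :=
      fun σ hσ i hi => hN σ i ((Finset.le_sup hσ).trans (by simpa using hi))
    convert (posSemidef_prod (Finset.range (v.support.sup N))
      (fun i (σ τ : Config) => labelKernel (σ.1 i) (τ.1 i))
      fun i => posSemidef_labelKernel.submatrix fun σ : Config => σ.1 i).2 v using 1
    refine Finset.sum_congr rfl fun σ hσ => Finset.sum_congr rfl fun τ hτ => ?_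
    simp only [Matrix.of_apply, configKernel_eq_prod (hs σ hσ) (hs τ hτ)]

end PosSemidef

/-- The action of `V_x` on labels of elementary tensors. -/
def shift (x : ℕ → NNReal) (hx : FinSupp x) (σ : Config) : Config :=
  ⟨fun i => ((σ.1 i).1, (σ.1 i).2.1, (σ.1 i).2.2 + x i), by
    obtain ⟨N, hN⟩ := σ.2
    obtain ⟨M, hM⟩ := hx
    refine ⟨max N M, fun n hn => ?_⟩
    simp [hN n (le_of_max_le_left hn), hM n (le_of_max_le_right hn), vac]⟩

/-- The action of `V_x*` on labels of elementary tensors. -/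
noncomputable def coshift (x : ℕ → NNReal) (hx : FinSupp x) (σ : Config) : Config :=
  ⟨fun i => ((σ.1 i).1, (σ.1 i).2.1 * Real.exp (-((x i - (σ.1 i).2.2 : NNReal) : ℝ)),
      (σ.1 i).2.2 - x i), by
    obtain ⟨N, hN⟩ := σ.2
    obtain ⟨M, hM⟩ := hx
    refine ⟨max N M, fun n hn => ?_⟩
    simp [hN n (le_of_max_le_left hn), hM n (le_of_max_le_right hn), vac]⟩

/-- Replace the label at site `i`. -/
def setAt (σ : Config) (i : ℕ) (a : Label) : Config :=
  ⟨Function.update σ.1 i a, by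
    obtain ⟨N, hN⟩ := σ.2
    refine ⟨max N (i + 1), fun n hn => ?_⟩
    rw [Function.update_of_ne (by have := le_of_max_le_right hn; omega),
      hN n (le_of_max_le_left hn)]⟩

@[simp]
theorem setAt_same (σ : Config) (i : ℕ) (a : Label) : (setAt σ i a).1 i = a :=
  Function.update_self (β := fun _ => Label) i a σ.1

theorem setAt_of_ne (σ : Config) {i j : ℕ} (h : j ≠ i) (a : Label) : (setAt σ i a).1 j = σ.1 j :=
  Function.update_of_ne (β := fun _ => Label) h a σ.1

@[simp]
theorem setAt_setAt (σ : Config) (i : ℕ) (a b : Label) : setAt (setAt σ i a) i b = setAt σ i b :=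
  Subtype.ext (Function.update_idem (β := fun _ => Label) a b σ.1)

theorem setAt_eq_self (σ : Config) (i : ℕ) : setAt σ i (σ.1 i) = σ :=
  Subtype.ext (Function.update_eq_self i σ.1)

theorem configKernel_shift_shift (x : ℕ → NNReal) (hx : FinSupp x) (σ τ : Config) :
    configKernel (shift x hx σ) (shift x hx τ) = configKernel σ τ :=
  finprod_congr fun i => by simp [labelKernel, shift]

theorem configKernel_shift_left (x : ℕ → NNReal) (hx : FinSupp x) (σ τ : Config) :
    configKernel (shift x hx σ) τ = configKernel σ (coshift x hx τ) := by
  refine finprod_congr fun i => ?_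
  simp only [labelKernel, shift, coshift, NNReal.coe_add]
  rw [mul_assoc (σ.1 i).2.1, mul_assoc (σ.1 i).2.1, mul_assoc (τ.1 i).2.1, ← Real.exp_add]
  rcases le_total (x i) (τ.1 i).2.2 with h | h
  · rw [tsub_eq_zero_of_le h, NNReal.coe_sub h, NNReal.coe_zero, neg_zero, zero_add]
    ring_nf
  · have h' : (0 : ℝ) ≤ x i - (τ.1 i).2.2 := sub_nonneg.mpr (NNReal.coe_le_coe.mpr h)
    have h'' : (0 : ℝ) ≤ (σ.1 i).2.2 := NNReal.coe_nonneg _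
    rw [tsub_eq_zero_of_le h, NNReal.coe_sub h, NNReal.coe_zero, sub_zero,
      abs_of_nonneg h'', abs_of_nonneg (by linarith)]
    ring_nf

theorem configKernel_eq_mul (σ τ : Config) (i : ℕ) :
    configKernel σ τ =
      labelKernel (σ.1 i) (τ.1 i) * configKernel (setAt σ i vac) (setAt τ i vac) := by
  obtain ⟨N, hN⟩ := σ.2
  obtain ⟨M, hM⟩ := τ.2
  let s := Finset.range (max (i + 1) (max N M))
  have hi : i ∈ s := by simp [s]
  have hs : ∀ j, j ∉ s → j ≠ i ∧ N ≤ j ∧ M ≤ j := fun j hj => by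
    simp only [s, Finset.mem_range, not_lt, max_le_iff] at hj
    exact ⟨by omega, hj.2⟩
  rw [configKernel_eq_prod (s := s) (fun j hj => hN j (hs j hj).2.1)
      (fun j hj => hM j (hs j hj).2.2),
    configKernel_eq_prod (s := s)
      (fun j hj => (setAt_of_ne σ (hs j hj).1 vac).trans (hN j (hs j hj).2.1))
      (fun j hj => (setAt_of_ne τ (hs j hj).1 vac).trans (hM j (hs j hj).2.2)),
    ← Finset.mul_prod_erase s _ hi, ← Finset.mul_prod_erase s _ hi, setAt_same, setAt_same,
    labelKernel_vac, one_mul]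
  congr 1
  refine Finset.prod_congr rfl fun j hj => ?_
  rw [setAt_of_ne σ (Finset.ne_of_mem_erase hj), setAt_of_ne τ (Finset.ne_of_mem_erase hj)]

theorem finSupp_single (i : ℕ) (t : NNReal) : FinSupp (Pi.single i t) :=
  ⟨i + 1, fun n hn => by
    have h : n ≠ i := by omega
    simp [h]⟩

theorem shift_single_setAt (i : ℕ) (t : NNReal) (σ : Config) (a : Label) :
    shift (Pi.single i t) (finSupp_single i t) (setAt σ i a) =
      setAt σ i (a.1, a.2.1, a.2.2 + t) := by
  refine Subtype.ext (funext fun j => ?_)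
  by_cases h : j = i
  · subst h
    simp [shift]
  · simp [shift, setAt_of_ne σ h, h]

theorem coshift_single_setAt (i : ℕ) (t : NNReal) (σ : Config) (a : Label) :
    coshift (Pi.single i t) (finSupp_single i t) (setAt σ i a) =
      setAt σ i (a.1, a.2.1 * Real.exp (-((t - a.2.2 : NNReal) : ℝ)), a.2.2 - t) := by
  refine Subtype.ext (funext fun j => ?_)
  by_cases h : j = i
  · subst h
    simp [coshift]
  · simp [coshift, setAt_of_ne σ h, h]

theorem shift_coshift_comm {i j : ℕ} (h : i ≠ j) (s t : NNReal) (σ : Config) :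
    shift (Pi.single i s) (finSupp_single i s)
        (coshift (Pi.single j t) (finSupp_single j t) σ) =
      coshift (Pi.single j t) (finSupp_single j t)
        (shift (Pi.single i s) (finSupp_single i s) σ) := by
  refine Subtype.ext (funext fun m => ?_)
  by_cases hm : m = i
  · subst hm
    simp [shift, coshift, h]
  · simp [shift, coshift, hm]

/-- Keep the unitary (`false`) or the pure (`true`) component of a label. -/
def mask (b : Bool) (a : Label) : Label := if b then (0, a.2) else (a.1, 0, a.2.2)

/-- Mask the labels at the sites below `n` according to `g`. -/
def maskBelow (g : ℕ → Bool) (σ : Config) : ℕ → Config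
  | 0 => σ
  | n + 1 => setAt (maskBelow g σ n) n (mask (g n) ((maskBelow g σ n).1 n))

theorem maskBelow_apply_of_le (g : ℕ → Bool) (σ : Config) {n m : ℕ} (h : n ≤ m) :
    (maskBelow g σ n).1 m = σ.1 m := by
  induction n with
  | zero => rfl
  | succ n ih => rw [maskBelow, setAt_of_ne _ (by omega), ih (by omega)]

theorem configKernel_maskBelow_succ (g : ℕ → Bool) (σ : Config) {n : ℕ} (h : σ.1 n = vac) :
    configKernel (maskBelow g σ (n + 1)) (maskBelow g σ (n + 1)) =
      configKernel (maskBelow g σ n) (maskBelow g σ n) / 2 := by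
  rw [configKernel_eq_mul (maskBelow g σ (n + 1)) _ n, configKernel_eq_mul (maskBelow g σ n) _ n]
  simp only [maskBelow, setAt_same, setAt_setAt, maskBelow_apply_of_le g σ le_rfl, h,
    labelKernel_vac]
  have : labelKernel (mask (g n) vac) (mask (g n) vac) = 1 / 2 := by
    cases g n <;> simp [mask, vac, labelKernel]
  rw [this]
  ring

theorem tendsto_configKernel_maskBelow (g : ℕ → Bool) (σ : Config) :
    Tendsto (fun n => configKernel (maskBelow g σ n) (maskBelow g σ n)) atTop (𝓝 0) := by
  obtain ⟨N, hN⟩ := σ.2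
  have h : ∀ n, configKernel (maskBelow g σ (n + N)) (maskBelow g σ (n + N)) =
      configKernel (maskBelow g σ N) (maskBelow g σ N) * (1 / 2) ^ n := fun n => by
    induction n with
    | zero => simp
    | succ n ih =>
      rw [Nat.add_right_comm, configKernel_maskBelow_succ g σ (hN _ (by omega)), ih, pow_succ]
      ring
  rw [← tendsto_add_atTop_iff_nat N]
  simp only [h]
  simpa using (tendsto_pow_atTop_nhds_zero_of_lt_one (r := (1 / 2 : ℝ)) (by norm_num)
    (by norm_num)).const_mul (configKernel (maskBelow g σ N) (maskBelow g σ N))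

section Hilbert

variable {H : Type} [NormedAddCommGroup H] [InnerProductSpace ℂ H] {e : Config → H}

theorem norm_sq_eq (he : ∀ σ τ, ⟪e σ, e τ⟫_ℂ = configKernel σ τ) (σ : Config) :
    ‖e σ‖ ^ 2 = configKernel σ σ := by
  have h := he σ σ
  rw [inner_self_eq_norm_sq_to_K] at h
  exact Complex.ofReal_injective (by simpa using h)

theorem norm_sub_sq_eq (he : ∀ σ τ, ⟪e σ, e τ⟫_ℂ = configKernel σ τ) (σ τ : Config) :
    ‖e σ - e τ‖ ^ 2 = configKernel σ σ - 2 * configKernel σ τ + configKernel τ τ := by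
  rw [norm_sub_sq (𝕜 := ℂ), norm_sq_eq he, norm_sq_eq he, he]
  simp

theorem continuous_of_coordinates (he : ∀ σ τ, ⟪e σ, e τ⟫_ℂ = configKernel σ τ)
    {T : Type} [TopologicalSpace T] (F : T → Config) (N : ℕ)
    (hN : ∀ t n, N ≤ n → (F t).1 n = vac) (hF : ∀ n, Continuous fun t => (F t).1 n) :
    Continuous fun t => e (F t) := by
  have hK : ∀ t u, configKernel (F t) (F u) =
      ∏ i ∈ Finset.range N, labelKernel ((F t).1 i) ((F u).1 i) := fun t u =>
    configKernel_eq_prod (fun i hi => hN t i (by simpa using hi))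
      (fun i hi => hN u i (by simpa using hi))
  have hc : Continuous fun p : T × T => configKernel (F p.1) (F p.2) := by
    simp only [hK]
    exact continuous_finsetProd _ fun i _ => continuous_labelKernel.comp
      (((hF i).comp continuous_fst).prodMk ((hF i).comp continuous_snd))
  refine continuous_iff_continuousAt.mpr fun u => ?_
  rw [ContinuousAt, tendsto_iff_norm_sub_tendsto_zero]
  have h : Continuous fun t => configKernel (F t) (F t) - 2 * configKernel (F t) (F u) +
      configKernel (F u) (F u) :=
    ((hc.comp (continuous_id.prodMk continuous_id)).sub
      ((hc.comp (continuous_id.prodMk continuous_const)).const_mul 2)).add continuous_const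
  have h0 := (h.tendsto u).sqrt
  simp only [← norm_sub_sq_eq he, Real.sqrt_sq (norm_nonneg _)] at h0
  rw [sub_self, norm_zero] at h0
  exact h0

theorem separableSpace_of_total (he : ∀ σ τ, ⟪e σ, e τ⟫_ℂ = configKernel σ τ)
    (hd : (Submodule.span ℂ (Set.range e)).topologicalClosure = ⊤) :
    TopologicalSpace.SeparableSpace H := by
  let F : (N : ℕ) → (Fin N → Label) → Config := fun N a =>
    ⟨fun n => if h : n < N then a ⟨n, h⟩ else vac, N, fun n hn => dif_neg (by omega)⟩
  have hF : ∀ N, Continuous fun a => e (F N a) := fun N =>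
    continuous_of_coordinates he (F N) N (fun a n hn => dif_neg (by omega)) fun n => by
      by_cases h : n < N
      · simp only [F, dif_pos h]
        exact continuous_apply (A := fun _ => Label) (⟨n, h⟩ : Fin N)
      · simp only [F, dif_neg h]
        exact continuous_const
  have hr : Set.range e = ⋃ N, Set.range fun a => e (F N a) := by
    refine subset_antisymm ?_ (Set.iUnion_subset fun N => ?_)
    · rintro _ ⟨σ, rfl⟩
      obtain ⟨N, hN⟩ := σ.2
      refine Set.mem_iUnion.mpr ⟨N, fun i => σ.1 i, congrArg e (Subtype.ext (funext fun n => ?_))⟩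
      by_cases h : n < N
      · simp [F, h]
      · simp [F, h, hN n (by omega)]
    · rintro _ ⟨a, rfl⟩
      exact ⟨_, rfl⟩
  have hs : TopologicalSpace.IsSeparable (Set.range e) := by
    rw [hr]
    exact .iUnion fun N => TopologicalSpace.isSeparable_range (hF N)
  have hs' := (hs.span (R := ℂ)).closure
  rw [← Submodule.topologicalClosure_coe, hd, Submodule.top_coe] at hs'
  exact TopologicalSpace.isSeparable_univ_iff.mp hs'

theorem setAt_eq_add (he : ∀ σ τ, ⟪e σ, e τ⟫_ℂ = configKernel σ τ)
    (hd : (Submodule.span ℂ (Set.range e)).topologicalClosure = ⊤) (σ : Config) (i : ℕ)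
    (a : Label) :
    e (setAt σ i a) = e (setAt σ i (mask false a)) + e (setAt σ i (mask true a)) := by
  refine eq_of_inner_total hd fun τ => ?_
  rw [inner_add_left, he, he, he, configKernel_eq_mul _ τ i,
    configKernel_eq_mul (setAt σ i (mask false a)) τ i,
    configKernel_eq_mul (setAt σ i (mask true a)) τ i]
  simp only [setAt_same, setAt_setAt, labelKernel, mask]
  push_cast
  simp
  ring

variable [CompleteSpace H] {V : (ℕ → NNReal) → H →L[ℂ] H}

theorem adjoint_apply_config (he : ∀ σ τ, ⟪e σ, e τ⟫_ℂ = configKernel σ τ)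
    (hd : (Submodule.span ℂ (Set.range e)).topologicalClosure = ⊤)
    (hV : ∀ x hx σ, V x (e σ) = e (shift x hx σ)) (x : ℕ → NNReal) (hx : FinSupp x)
    (σ : Config) : adjoint (V x) (e σ) = e (coshift x hx σ) := by
  refine eq_of_inner_total hd fun τ => ?_
  rw [adjoint_inner_left, hV x hx, he, he, configKernel_comm, configKernel_shift_left,
    configKernel_comm]

/-- A vector in the range of every `V_{t e_i}` is orthogonal to the pure part at site `i`. -/
theorem inner_mask_true_eq_zero (he : ∀ σ τ, ⟪e σ, e τ⟫_ℂ = configKernel σ τ)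
    (hd : (Submodule.span ℂ (Set.range e)).topologicalClosure = ⊤)
    (hV : ∀ x hx σ, V x (e σ) = e (shift x hx σ))
    (hVn : ∀ x, FinSupp x → ∀ ξ, ‖V x ξ‖ = ‖ξ‖) {ξ : H} {i : ℕ}
    (hξ : ∀ t : NNReal, ∃ η, V (Pi.single i t) η = ξ) (σ : Config) (a : Label) :
    ⟪ξ, e (setAt σ i (mask true a))⟫_ℂ = 0 := by
  obtain ⟨p, q, s⟩ := a
  set C := configKernel (setAt σ i vac) (setAt σ i vac)
  have hb : ∀ n : ℕ, ‖⟪ξ, e (setAt σ i (mask true (p, q, s)))⟫_ℂ‖ ≤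
      ‖ξ‖ * √((q * Real.exp (-n)) ^ 2 / 2 * C) := fun n => by
    have hx := finSupp_single i (s + n)
    obtain ⟨η, rfl⟩ := hξ (s + n)
    rw [← adjoint_inner_right, adjoint_apply_config he hd hV _ hx, hVn _ hx]
    refine (norm_inner_le_norm _ _).trans (mul_le_mul_of_nonneg_left ?_ (norm_nonneg _))
    refine Real.le_sqrt_of_sq_le ?_
    rw [norm_sq_eq he, coshift_single_setAt, configKernel_eq_mul _ _ i]
    simp only [setAt_same, setAt_setAt]
    refine le_of_eq (congrArg (· * C) ?_)
    simp [labelKernel, mask]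
    ring
  have hl : Tendsto (fun n : ℕ => ‖ξ‖ * √((q * Real.exp (-n)) ^ 2 / 2 * C)) atTop (𝓝 0) := by
    have h : Tendsto (fun n : ℕ => Real.exp (-n)) atTop (𝓝 0) :=
      Real.tendsto_exp_neg_atTop_nhds_zero.comp tendsto_natCast_atTop_atTop
    simpa using (((((h.const_mul q).pow 2).div_const 2).mul_const C).sqrt).const_mul ‖ξ‖
  exact norm_le_zero_iff.mp (ge_of_tendsto' hl hb)

/-- A vector on which the `V_{t e_i}*` tend to zero is orthogonal to the unitary part at
site `i`. -/
theorem inner_mask_false_eq_zero (he : ∀ σ τ, ⟪e σ, e τ⟫_ℂ = configKernel σ τ)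
    (hd : (Submodule.span ℂ (Set.range e)).topologicalClosure = ⊤)
    (hV : ∀ x hx σ, V x (e σ) = e (shift x hx σ)) {ξ : H} {i : ℕ}
    (hξ : Tendsto (fun t : NNReal => adjoint (V (Pi.single i t)) ξ) atTop (𝓝 0))
    (σ : Config) (a : Label) :
    ⟪ξ, e (setAt σ i (mask false a))⟫_ℂ = 0 := by
  have h : ∀ t : NNReal, ⟪adjoint (V (Pi.single i t)) ξ, e (setAt σ i (mask false a))⟫_ℂ =
      ⟪ξ, e (setAt σ i (mask false a))⟫_ℂ := fun t => by
    rw [adjoint_inner_left, hV _ (finSupp_single i t), shift_single_setAt]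
    congr 1
    refine eq_of_inner_total hd fun τ => ?_
    rw [he, he, configKernel_eq_mul _ τ i, configKernel_eq_mul (setAt σ i (mask false a)) τ i]
    simp [labelKernel, mask]
  have hl := hξ.inner (tendsto_const_nhds (x := e (setAt σ i (mask false a)))) (𝕜 := ℂ)
  simp only [h, inner_zero_left] at hl
  exact tendsto_nhds_unique tendsto_const_nhds hl

/-- No nonzero vector has a pure or unitary type at every site. -/
theorem eq_zero_of_type (he : ∀ σ τ, ⟪e σ, e τ⟫_ℂ = configKernel σ τ)
    (hd : (Submodule.span ℂ (Set.range e)).topologicalClosure = ⊤)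
    (hV : ∀ x hx σ, V x (e σ) = e (shift x hx σ))
    (hVn : ∀ x, FinSupp x → ∀ ξ, ‖V x ξ‖ = ‖ξ‖) (g : ℕ → Bool) {ξ : H}
    (hu : ∀ i, g i = false → ∀ t : NNReal, ∃ η, V (Pi.single i t) η = ξ)
    (hp : ∀ i, g i = true →
      Tendsto (fun t : NNReal => adjoint (V (Pi.single i t)) ξ) atTop (𝓝 0)) : ξ = 0 := by
  refine eq_of_inner_total hd fun σ => ?_
  have hm : ∀ n, ⟪ξ, e (maskBelow g σ n)⟫_ℂ = ⟪ξ, e σ⟫_ℂ := fun n => by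
    induction n with
    | zero => rfl
    | succ n ih =>
      have hs := setAt_eq_add he hd (maskBelow g σ n) n ((maskBelow g σ n).1 n)
      rw [setAt_eq_self] at hs
      rw [← ih, hs, inner_add_right, maskBelow]
      cases h : g n with
      | false => rw [inner_mask_true_eq_zero he hd hV hVn (hu n h), add_zero]
      | true => rw [inner_mask_false_eq_zero he hd hV (hp n h), zero_add]
  have hl := ((tendsto_configKernel_maskBelow g σ).sqrt).const_mul ‖ξ‖
  rw [Real.sqrt_zero, mul_zero] at hl
  rw [inner_zero_left]
  refine norm_le_zero_iff.mp (ge_of_tendsto' hl fun n => ?_)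
  rw [← hm n, ← norm_sq_eq he, Real.sqrt_sq (norm_nonneg _)]
  exact norm_inner_le_norm _ _

end Hilbert

/-- failure of Wold decomposition for `ℝ₊^∞`: there exist a nonzero separable
complex Hilbert space `H` and a doubly commuting isometric representation `V` of `ℝ₊^∞` on
`H` (strongly continuous on each finite block) which admits no Wold decomposition, i.e. no
family `(H_g)_{g ∈ {0,1}^ℕ}` of pairwise orthogonal closed reducing subspaces with dense
total span such that on `H_g` the semigroup `(V_{t e_i})_{t ≥ 0}` is unitary when `g i = 0`
and pure when `g i = 1`. -/
theorem stmt_19 :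
    ∃ (H : Type) (_ : NormedAddCommGroup H) (_ : InnerProductSpace ℂ H)
      (_ : CompleteSpace H) (_ : TopologicalSpace.SeparableSpace H)
      (V : (ℕ → NNReal) → H →L[ℂ] H),
      Nontrivial H ∧
      V 0 = 1 ∧
      (∀ x y : ℕ → NNReal, FinSupp x → FinSupp y → V (x + y) = V x * V y) ∧
      (∀ x : ℕ → NNReal, FinSupp x → ∀ ξ : H, ‖V x ξ‖ = ‖ξ‖) ∧
      (∀ i j : ℕ, i ≠ j → ∀ s t : NNReal,
        V (Pi.single i s) * adjoint (V (Pi.single j t))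
          = adjoint (V (Pi.single j t)) * V (Pi.single i s)) ∧
      (∀ (n : ℕ) (ξ : H), Continuous fun t : Fin n → NNReal =>
        V (fun m => if h : m < n then t ⟨m, h⟩ else 0) ξ) ∧
      ¬ ∃ Hg : (ℕ → Bool) → Submodule ℂ H,
          (∀ g, IsClosed (Hg g : Set H)) ∧
          (∀ g g' : ℕ → Bool, g ≠ g' → ∀ x ∈ Hg g, ∀ y ∈ Hg g', ⟪x, y⟫_ℂ = 0) ∧
          (⨆ g, Hg g).topologicalClosure = ⊤ ∧
          (∀ (g : ℕ → Bool) (x : ℕ → NNReal), FinSupp x →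
            ∀ ξ ∈ Hg g, V x ξ ∈ Hg g ∧ adjoint (V x) ξ ∈ Hg g) ∧
          (∀ (g : ℕ → Bool) (i : ℕ), g i = false → ∀ t : NNReal,
            Submodule.map (V (Pi.single i t)).toLinearMap (Hg g) = Hg g) ∧
          (∀ (g : ℕ → Bool) (i : ℕ), g i = true → ∀ ξ ∈ Hg g,
            Tendsto (fun t : NNReal => adjoint (V (Pi.single i t)) ξ) atTop (𝓝 0)) := by
  obtain ⟨H, _, _, _, e, he, hd⟩ := exists_hilbert_of_posSemidef _ posSemidef_configKernel
  have hex : ∀ x : ℕ → NNReal, ∃ W : H →L[ℂ] H, ∀ hx : FinSupp x,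
      (∀ σ, W (e σ) = e (shift x hx σ)) ∧ ∀ ξ, ‖W ξ‖ = ‖ξ‖ := fun x => by
    by_cases hx : FinSupp x
    · obtain ⟨W, hW⟩ := exists_isometry_of_kernel he hd (shift x hx)
        (configKernel_shift_shift x hx)
      exact ⟨W, fun _ => hW⟩
    · exact ⟨0, fun h => absurd h hx⟩
  choose V hV' using hex
  have hV : ∀ x hx σ, V x (e σ) = e (shift x hx σ) := fun x hx => (hV' x hx).1
  have hVn : ∀ x, FinSupp x → ∀ ξ, ‖V x ξ‖ = ‖ξ‖ := fun x hx => (hV' x hx).2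
  have hext : ∀ {A B : H →L[ℂ] H}, (∀ σ, A (e σ) = B (e σ)) → A = B := fun h =>
    ContinuousLinearMap.ext_on (Submodule.dense_iff_topologicalClosure_eq_top.mpr hd)
      (by rintro _ ⟨σ, rfl⟩; exact h σ)
  have h0 : FinSupp 0 := ⟨0, fun _ _ => rfl⟩
  have hnt : Nontrivial H := by
    refine ⟨e ⟨fun _ => vac, 0, fun _ _ => rfl⟩, 0, fun h => ?_⟩
    have h1 := norm_sq_eq he ⟨fun _ => vac, 0, fun _ _ => rfl⟩
    rw [h, configKernel_eq_prod (s := ∅) (fun _ _ => rfl) (fun _ _ => rfl)] at h1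
    simp at h1
  refine ⟨H, _, _, inferInstance, separableSpace_of_total he hd, V, hnt, hext fun σ => ?_,
    fun x y hx hy => hext fun σ => ?_, hVn, fun i j hij s t => hext fun σ => ?_,
    fun n ξ => ?_, ?_⟩
  · rw [hV 0 h0, one_apply_eq_self]
    exact congrArg e (Subtype.ext (funext fun i => by simp [shift]))
  · have hxy : FinSupp (x + y) := by
      obtain ⟨N, hN⟩ := hx
      obtain ⟨M, hM⟩ := hy
      exact ⟨max N M, fun n hn => by
        simp [hN n (le_of_max_le_left hn), hM n (le_of_max_le_right hn)]⟩
    rw [ContinuousLinearMap.mul_def, ContinuousLinearMap.comp_apply, hV y hy, hV x hx, hV _ hxy]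
    exact congrArg e (Subtype.ext (funext fun i => by
      simp [shift, add_assoc, add_comm (x i)]))
  · simp only [ContinuousLinearMap.mul_def, ContinuousLinearMap.comp_apply]
    rw [adjoint_apply_config he hd hV _ (finSupp_single j t),
      hV _ (finSupp_single i s), hV _ (finSupp_single i s),
      adjoint_apply_config he hd hV _ (finSupp_single j t), shift_coshift_comm hij]
  · let x : (Fin n → NNReal) → ℕ → NNReal := fun t m => if h : m < n then t ⟨m, h⟩ else 0
    have hx : ∀ t, FinSupp (x t) := fun t => ⟨n, fun m hm => dif_neg (by omega)⟩
    have hxc : ∀ m, Continuous fun t => x t m := fun m => by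
      by_cases h : m < n
      · simp only [x, dif_pos h]
        exact continuous_apply (A := fun _ => NNReal) (⟨m, h⟩ : Fin n)
      · simp only [x, dif_neg h]
        exact continuous_const
    change Continuous fun t => V (x t) ξ
    let S : Submodule ℂ H :=
      { carrier := {ξ | Continuous fun t => V (x t) ξ}
        add_mem' := fun {a b} ha hb => by
          simp only [Set.mem_ofPred_eq, map_add] at ha hb ⊢
          exact ha.add hb
        zero_mem' := by simpa using continuous_const
        smul_mem' := fun c a ha => by
          simp only [Set.mem_ofPred_eq, map_smul] at ha ⊢
          exact ha.const_smul c }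
    have hSe : Set.range e ⊆ S := by
      rintro _ ⟨σ, rfl⟩
      change Continuous fun t => V (x t) (e σ)
      simp only [fun t => hV (x t) (hx t) σ]
      obtain ⟨N, hN⟩ := σ.2
      refine continuous_of_coordinates he _ (max N n) (fun t m hm => ?_) fun m => ?_
      · simp [shift, hN m (le_of_max_le_left hm), vac, x, le_of_max_le_right hm]
      · exact continuous_const.prodMk (continuous_const.prodMk (continuous_const.add (hxc m)))
    have hSc : IsClosed (S : Set H) := by
      refine isClosed_of_closure_subset fun ξ hξ => ?_
      change Continuous fun t => V (x t) ξ
      refine continuous_of_uniform_approx_of_continuous fun u hu => ?_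
      obtain ⟨ε, hε, hεu⟩ := Metric.mem_uniformity_dist.mp hu
      obtain ⟨η, hη, hd'⟩ := Metric.mem_closure_iff.mp hξ ε hε
      refine ⟨fun t => V (x t) η, hη, fun t => hεu ?_⟩
      rwa [dist_eq_norm, ← map_sub, hVn _ (hx t), ← dist_eq_norm]
    have hS : S = ⊤ := top_le_iff.mp (hd ▸
      Submodule.topologicalClosure_minimal _ (Submodule.span_le.mpr hSe) hSc)
    exact (hS ▸ Submodule.mem_top : ξ ∈ S)
  · rintro ⟨Hg, -, -, hdense, -, hu, hp⟩
    have hbot : ∀ g, Hg g = ⊥ := fun g => (Submodule.eq_bot_iff _).mpr fun ξ hξ =>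
      eq_zero_of_type he hd hV hVn g
        (fun i hi t => by
          rw [← hu g i hi t] at hξ
          obtain ⟨η, -, hη⟩ := hξ
          exact ⟨η, hη⟩)
        fun i hi => hp g i hi ξ hξ
    simp only [hbot, iSup_bot] at hdense
    rw [IsClosed.submodule_topologicalClosure_eq (by simp)] at hdense
    exact bot_ne_top hdense
end
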